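/- Let m ≥ 2 and let f̃ : Ω̃ → ℝ_{0,m} be real-analytic on an open set Ω̃ ⊆ ℝ^{m−1}, identified with {X ∈ ℝ^m : X_m = 0}. Then there exists an open neighbourhood Ω of Ω̃ × {0} in ℝ^m and a monogenic function f : Ω → ℝ_{0,m} (i.e. ∂f = 0 on Ω) with f(X₁,…,X_{m−1},0) = f̃(X₁,…,X_{m−1}) for all (X₁,…,X_{m−1}) ∈ Ω̃; moreover f is unique in the sense that any two monogenic functions defined on open neighbourhoods of Ω̃ × {0} in ℝ^m and both restricting to f̃ on Ω̃ × {0} agree on some open neighbourhood of Ω̃ × {0}. -/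

import Mathlib

noncomputable section

/-- The negative definite quadratic form `-∑ vᵢ²` on `K^m`. -/
def negQ (K : Type) [Field K] (m : ℕ) : QuadraticForm K (Fin m → K) :=
  QuadraticMap.weightedSumSquares K (fun _ : Fin m => (-1 : K))

/-- The real Clifford algebra `ℝ_{0,m}`. -/
abbrev ClR (m : ℕ) : Type := CliffordAlgebra (negQ ℝ m)

/-- The generators `e_α` of `ℝ_{0,m}`, satisfying `e_α e_β + e_β e_α = -2 δ_{αβ}`. -/
def er (m : ℕ) (α : Fin m) : ClR m := CliffordAlgebra.ι (negQ ℝ m) (Pi.single α 1)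

/-- `f` has directional derivative `d` at `z` in direction `v` (componentwise, i.e. tested
against all linear functionals on the finite-dimensional space `ℝ_{0,m}`). -/
def HasDirDerivR {m k : ℕ} (f : (Fin k → ℝ) → ClR m) (z v : Fin k → ℝ) (d : ClR m) : Prop :=
  ∀ φ : ClR m →ₗ[ℝ] ℝ, HasDerivAt (fun t : ℝ => φ (f (z + t • v))) (φ d) 0

/-- The directional derivative of `f` at `z` in direction `v` (junk value if it does not exist). -/
def dirDerivR {m k : ℕ} (f : (Fin k → ℝ) → ClR m) (v z : Fin k → ℝ) : ClR m :=
  letI : Nonempty (ClR m) := ⟨0⟩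
  Classical.epsilon fun d => HasDirDerivR f z v d

/-- The Dirac operator `∂ f = ∑_α e_α ∂f/∂X_α` on `ℝ_{0,m}`-valued functions on `ℝ^m`. -/
def diracR (m : ℕ) (f : (Fin m → ℝ) → ClR m) (X : Fin m → ℝ) : ClR m :=
  ∑ α : Fin m, er m α * dirDerivR f (Pi.single α 1) X

/-- The restricted Dirac operator `∂̃ g = ∑_{α<m} e_α ∂g/∂X_α` on functions of `m-1` variables. -/
def diracTR (m : ℕ) (g : (Fin (m - 1) → ℝ) → ClR m) (x : Fin (m - 1) → ℝ) : ClR m :=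
  ∑ α : Fin (m - 1), er m (Fin.castLE (Nat.sub_le m 1) α) * dirDerivR g (Pi.single α 1) x

/-- The embedding `ℝ^{m-1} ≃ {X ∈ ℝ^m : X_m = 0} ⊆ ℝ^m`. -/
def embR (m : ℕ) (x : Fin (m - 1) → ℝ) : Fin m → ℝ :=
  fun i => if h : (i : ℕ) < m - 1 then x ⟨i, h⟩ else 0

/-- `f` is real-analytic on `Ω` (componentwise). -/
def RealAnalyticOnR {m k : ℕ} (f : (Fin k → ℝ) → ClR m) (Ω : Set (Fin k → ℝ)) : Prop :=
  ∀ φ : ClR m →ₗ[ℝ] ℝ, AnalyticOnNhd ℝ (fun x => φ (f x)) Ω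

/-- `f` is (left) monogenic on the open set `Ω ⊆ ℝ^m`: it is continuously differentiable
(componentwise) and satisfies `∂ f = 0` on `Ω`. -/
def MonogenicOn (m : ℕ) (f : (Fin m → ℝ) → ClR m) (Ω : Set (Fin m → ℝ)) : Prop :=
  (∀ φ : ClR m →ₗ[ℝ] ℝ, ContDiffOn ℝ 1 (fun X => φ (f X)) Ω) ∧
    ∀ X ∈ Ω, diracR m f X = 0

open Set Filter Topology MeasureTheory Metric
open scoped NNReal ENNReal ContDiff

section IteratedDerivBounds

open scoped Nat

theorem FormalMultilinearSeries.exists_nnnorm_changeOrigin_mul_pow_le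
    {E F : Type*} [NormedAddCommGroup E] [NormedSpace ℝ E]
    [NormedAddCommGroup F] [NormedSpace ℝ F] (p : FormalMultilinearSeries ℝ E F)
    {r r' : ℝ≥0} (hr : (r + r' : ℝ≥0∞) < p.radius) :
    ∃ C : ℝ≥0, ∀ y : E, ‖y‖₊ ≤ r → ∀ k, ‖p.changeOrigin y k‖₊ * r' ^ k ≤ C := by
  have hsum := p.changeOriginSeries_summable_aux₁ hr
  refine ⟨_, fun y hy k => le_trans ?_ ((NNReal.summable_sigma.1 hsum).2.le_tsum k (by simp))⟩
  have hr1 : (r : ℝ≥0∞) < p.radius := lt_of_le_of_lt le_self_add hr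
  have hy' : (‖y‖₊ : ℝ≥0∞) < p.radius := lt_of_le_of_lt (by exact_mod_cast hy) hr1
  have h1 := p.nnnorm_changeOrigin_le k hy'
  have h2 := p.changeOriginSeries_summable_aux₂ hr1 k
  have h3 : (∑' s : Σ l : ℕ, { s : Finset (Fin (k + l)) // s.card = l },
      ‖p (k + s.1)‖₊ * ‖y‖₊ ^ s.1) ≤ ∑' s : Σ l : ℕ, { s : Finset (Fin (k + l)) // s.card = l },
      ‖p (k + s.1)‖₊ * r ^ s.1 := by
    refine Summable.tsum_le_tsum (fun s => by gcongr) ?_ h2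
    exact p.changeOriginSeries_summable_aux₂ hy' k
  calc _ ≤ (∑' s : Σ l : ℕ, { s : Finset (Fin (k + l)) // s.card = l },
      ‖p (k + s.1)‖₊ * r ^ s.1) * r' ^ k := by gcongr; exact h1.trans h3
    _ = _ := (NNReal.tsum_mul_right _ _).symm

theorem AnalyticAt.exists_norm_iteratedFDeriv_le
    {E F : Type*} [NormedAddCommGroup E] [NormedSpace ℝ E]
    [NormedAddCommGroup F] [NormedSpace ℝ F] [CompleteSpace F] {f : E → F} {x : E}
    (hf : AnalyticAt ℝ f x) :
    ∃ C R : ℝ, 0 ≤ C ∧ 0 ≤ R ∧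
      ∀ᶠ y in 𝓝 x, ∀ n, ‖iteratedFDeriv ℝ n f y‖ ≤ C * R ^ n * n ! := by
  obtain ⟨p, ρ, hp⟩ := hf
  obtain ⟨r, hr0, hr⟩ := ENNReal.lt_iff_exists_nnreal_btwn.1 hp.r_pos
  have hr0' : 0 < r := by exact_mod_cast hr0
  have hhalf : ((r / 2 : ℝ≥0) : ℝ≥0∞) + ((r / 2 : ℝ≥0) : ℝ≥0∞) < p.radius := by
    rw [← ENNReal.coe_add, add_halves]
    exact hr.trans_le hp.r_le
  obtain ⟨C, hC⟩ := p.exists_nnnorm_changeOrigin_mul_pow_le hhalf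
  refine ⟨C, ((r / 2 : ℝ≥0) : ℝ)⁻¹, C.2, by positivity, ?_⟩
  have hball : closedBall x ((r / 2 : ℝ≥0) : ℝ) ∈ 𝓝 x :=
    closedBall_mem_nhds _ (by positivity)
  filter_upwards [hball] with y hy n
  have hy1 : ‖y - x‖₊ ≤ r / 2 := by
    rw [mem_closedBall, dist_eq_norm] at hy
    exact_mod_cast hy
  have hy2 : (‖y - x‖₊ : ℝ≥0∞) < ρ := by
    refine lt_of_le_of_lt ?_ hr
    exact_mod_cast hy1.trans (half_le_self r.2)
  have hq := hp.changeOrigin hy2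
  rw [add_sub_cancel] at hq
  have hb : ‖p.changeOrigin (y - x) n‖ ≤ C * ((r / 2 : ℝ≥0) : ℝ)⁻¹ ^ n := by
    have h := hC (y - x) hy1 n
    have h' : ‖p.changeOrigin (y - x) n‖ * ((r / 2 : ℝ≥0) : ℝ) ^ n ≤ C := by exact_mod_cast h
    rw [inv_pow, ← div_eq_mul_inv, le_div_iff₀ (by positivity)]
    exact h'
  refine ContinuousMultilinearMap.opNorm_le_bound (by positivity) fun v => ?_
  rw [hq.iteratedFDeriv_eq_sum_of_completeSpace]
  calc _ ≤ ∑ σ : Equiv.Perm (Fin n), ‖p.changeOrigin (y - x) n fun i => v (σ i)‖ :=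
        norm_sum_le _ _
    _ ≤ ∑ σ : Equiv.Perm (Fin n), ‖p.changeOrigin (y - x) n‖ * ∏ i, ‖v i‖ := by
        refine Finset.sum_le_sum fun σ _ => ?_
        refine (ContinuousMultilinearMap.le_opNorm _ _).trans_eq ?_
        rw [Equiv.prod_comp σ (fun i => ‖v i‖)]
    _ = n ! * (‖p.changeOrigin (y - x) n‖ * ∏ i, ‖v i‖) := by
        simp [Fintype.card_perm]
    _ ≤ n ! * ((C * ((r / 2 : ℝ≥0) : ℝ)⁻¹ ^ n) * ∏ i, ‖v i‖) := by gcongr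
    _ = _ := by ring

end IteratedDerivBounds

theorem AnalyticAt.iteratedFDeriv' {E V : Type*} [NormedAddCommGroup E] [NormedSpace ℝ E]
    [NormedAddCommGroup V] [NormedSpace ℝ V] [CompleteSpace V] {f : E → V} {x : E}
    (hf : AnalyticAt ℝ f x) (k : ℕ) : AnalyticAt ℝ (iteratedFDeriv ℝ k f) x :=
  AnalyticOnNhd.iteratedFDeriv (s := {x}) (fun y hy => by rwa [mem_singleton_iff.1 hy]) k x
    (mem_singleton x)

section CauchyKovalevskaya

open scoped Nat

variable {ι E V : Type*} [Fintype ι] [NormedAddCommGroup E] [NormedSpace ℝ E]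
  [NormedAddCommGroup V] [NormedSpace ℝ V]

/-- The functional `T ↦ ∑_w A_{w₁} ⋯ A_{w_k} T(e_{w₁}, …, e_{w_k})`, i.e. the symbol of the `k`-th
power of the operator `∑ᵢ Aᵢ ∂_{eᵢ}`. -/
def powSymbol (e : ι → E) (A : ι → V →L[ℝ] V) : (k : ℕ) → (E [×k]→L[ℝ] V) →L[ℝ] V
  | 0 => (continuousMultilinearCurryFin0 ℝ E V : (E [×0]→L[ℝ] V) →L[ℝ] V)
  | k + 1 => ∑ i, (A i ∘L powSymbol e A k) ∘L
      (ContinuousLinearMap.apply ℝ (E [×k]→L[ℝ] V) (e i) ∘L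
        ((continuousMultilinearCurryLeftEquiv ℝ (fun _ : Fin (k + 1) => E) V :
          (E [×(k + 1)]→L[ℝ] V) →L[ℝ] (E →L[ℝ] (E [×k]→L[ℝ] V)))))

theorem powSymbol_succ (e : ι → E) (A : ι → V →L[ℝ] V) (k : ℕ) (T : E [×(k + 1)]→L[ℝ] V) :
    powSymbol e A (k + 1) T = ∑ i, A i (powSymbol e A k (T.curryLeft (e i))) := by
  simp only [powSymbol, FunLike.coe_sum, Finset.sum_apply]
  rfl

theorem norm_powSymbol_le (e : ι → E) (A : ι → V →L[ℝ] V) (k : ℕ) (T : E [×k]→L[ℝ] V) :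
    ‖powSymbol e A k T‖ ≤ (∑ i, ‖A i‖ * ‖e i‖) ^ k * ‖T‖ := by
  induction k with
  | zero =>
    rw [pow_zero, one_mul]
    exact ((continuousMultilinearCurryFin0 ℝ E V).norm_map T).le
  | succ k ih =>
    rw [powSymbol_succ]
    calc _ ≤ ∑ i, ‖A i‖ * ((∑ i, ‖A i‖ * ‖e i‖) ^ k * (‖T‖ * ‖e i‖)) := by
          refine norm_sum_le_of_le _ fun i _ => (A i).le_opNorm_of_le ((ih _).trans ?_)
          gcongr
          refine (T.curryLeft.le_opNorm _).trans_eq ?_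
          rw [ContinuousMultilinearMap.curryLeft_norm]
      _ = _ := by
          rw [pow_succ, Finset.mul_sum, Finset.sum_mul]
          exact Finset.sum_congr rfl fun i _ => by ring

/-- The `k`-th iterate of the operator `∑ᵢ Aᵢ ∂_{eᵢ}` applied to `f`. -/
def powDirac (e : ι → E) (A : ι → V →L[ℝ] V) (f : E → V) (k : ℕ) (x : E) : V :=
  powSymbol e A k (iteratedFDeriv ℝ k f x)

theorem powDirac_zero (e : ι → E) (A : ι → V →L[ℝ] V) (f : E → V) (x : E) :
    powDirac e A f 0 x = f x := by
  simp [powDirac, powSymbol]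

/-- The Fréchet derivative of `powDirac`. -/
def powDiracDeriv (e : ι → E) (A : ι → V →L[ℝ] V) (f : E → V) (k : ℕ) (x : E) : E →L[ℝ] V :=
  powSymbol e A k ∘L fderiv ℝ (iteratedFDeriv ℝ k f) x

theorem hasFDerivAt_powDirac [CompleteSpace V] (e : ι → E) (A : ι → V →L[ℝ] V) {f : E → V} (k : ℕ)
    {x : E} (hf : AnalyticAt ℝ f x) :
    HasFDerivAt (powDirac e A f k) (powDiracDeriv e A f k x) x :=
  (powSymbol e A k).hasFDerivAt.comp x (hf.iteratedFDeriv' k).differentiableAt.hasFDerivAt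

theorem powDirac_succ (e : ι → E) (A : ι → V →L[ℝ] V) (f : E → V) (k : ℕ) (x : E) :
    powDirac e A f (k + 1) x = ∑ i, A i (powDiracDeriv e A f k x (e i)) := by
  rw [powDirac, powSymbol_succ]
  rfl

theorem norm_powDiracDeriv_le (e : ι → E) (A : ι → V →L[ℝ] V) (f : E → V) (k : ℕ) (x : E) :
    ‖powDiracDeriv e A f k x‖ ≤
      (∑ i, ‖A i‖ * ‖e i‖) ^ k * ‖iteratedFDeriv ℝ (k + 1) f x‖ := by
  rw [← norm_fderiv_iteratedFDeriv]
  refine ContinuousLinearMap.opNorm_le_bound _ (by positivity) fun v => ?_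
  refine (norm_powSymbol_le e A k _).trans ?_
  rw [mul_assoc]
  gcongr
  exact ContinuousLinearMap.le_opNorm _ _

theorem continuousAt_powDirac [CompleteSpace V] (e : ι → E) (A : ι → V →L[ℝ] V) {f : E → V}
    (k : ℕ) {x : E} (hf : AnalyticAt ℝ f x) : ContinuousAt (powDirac e A f k) x :=
  (hasFDerivAt_powDirac e A k hf).continuousAt

theorem continuousAt_powDiracDeriv [CompleteSpace V] (e : ι → E) (A : ι → V →L[ℝ] V) {f : E → V}
    (k : ℕ) {x : E} (hf : AnalyticAt ℝ f x) : ContinuousAt (powDiracDeriv e A f k) x :=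
  continuousAt_const.clm_comp (hf.iteratedFDeriv' k).fderiv.continuousAt

theorem exists_norm_powDirac_le [CompleteSpace V] (e : ι → E) (A : ι → V →L[ℝ] V) {f : E → V}
    {x : E} (hf : AnalyticAt ℝ f x) :
    ∃ C q : ℝ, 0 ≤ C ∧ 0 < q ∧ ∀ᶠ y in 𝓝 x, AnalyticAt ℝ f y ∧
      ∀ k, ‖powDirac e A f k y‖ ≤ C * q ^ k * k ! ∧
        ‖powDiracDeriv e A f k y‖ ≤ C * q ^ (k + 1) * (k + 1)! := by
  obtain ⟨C, R, hC, hR, h⟩ := hf.exists_norm_iteratedFDeriv_le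
  set M : ℝ := ∑ i, ‖A i‖ * ‖e i‖ with hM
  have hM0 : 0 ≤ M := by positivity
  refine ⟨C, (M + 1) * (R + 1), hC, by positivity, ?_⟩
  filter_upwards [h, hf.eventually_analyticAt] with y hy hya
  have hpow (k : ℕ) : M ^ k ≤ (M + 1) ^ k := by gcongr; linarith
  refine ⟨hya, fun k => ⟨?_, ?_⟩⟩
  · calc _ ≤ M ^ k * ‖iteratedFDeriv ℝ k f y‖ := norm_powSymbol_le e A k _
      _ ≤ (M + 1) ^ k * (C * (R + 1) ^ k * k !) := by
          refine mul_le_mul (hpow k) ((hy k).trans ?_) (norm_nonneg _) (by positivity)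
          gcongr
          linarith
      _ = _ := by rw [mul_pow]; ring
  · calc _ ≤ M ^ k * ‖iteratedFDeriv ℝ (k + 1) f y‖ := norm_powDiracDeriv_le e A f k y
      _ ≤ (M + 1) ^ (k + 1) * (C * (R + 1) ^ (k + 1) * (k + 1)!) := by
          refine mul_le_mul ((hpow k).trans ?_) ((hy (k + 1)).trans ?_) (norm_nonneg _)
            (by positivity)
          · exact pow_le_pow_right₀ (by linarith) (Nat.le_succ k)
          · gcongr
            linarith
      _ = _ := by rw [mul_pow]; ring

/-- The `k`-th term `t^k / k! • D^k f` of the Cauchy–Kovalevskaya series. -/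
def ckTerm (e : ι → E) (A : ι → V →L[ℝ] V) (f : E → V) (k : ℕ) (p : E × ℝ) : V :=
  (p.2 ^ k / k !) • powDirac e A f k p.1

/-- The Fréchet derivative of `ckTerm`. -/
def ckTermDeriv (e : ι → E) (A : ι → V →L[ℝ] V) (f : E → V) (k : ℕ) (p : E × ℝ) :
    E × ℝ →L[ℝ] V :=
  (p.2 ^ k / k !) • (powDiracDeriv e A f k p.1 ∘L ContinuousLinearMap.fst ℝ E ℝ) +
    ((k * p.2 ^ (k - 1) / k !) • ContinuousLinearMap.snd ℝ E ℝ).smulRight (powDirac e A f k p.1)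

theorem hasFDerivAt_ckTerm [CompleteSpace V] (e : ι → E) (A : ι → V →L[ℝ] V) {f : E → V} (k : ℕ)
    {p : E × ℝ} (hf : AnalyticAt ℝ f p.1) :
    HasFDerivAt (ckTerm e A f k) (ckTermDeriv e A f k p) p := by
  have h1 : HasFDerivAt (fun p : E × ℝ => powDirac e A f k p.1)
      (powDiracDeriv e A f k p.1 ∘L ContinuousLinearMap.fst ℝ E ℝ) p :=
    (hasFDerivAt_powDirac e A k hf).comp p hasFDerivAt_fst
  have h2 : HasFDerivAt (fun p : E × ℝ => p.2 ^ k / (k ! : ℝ))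
      ((k * p.2 ^ (k - 1) / k ! : ℝ) • ContinuousLinearMap.snd ℝ E ℝ) p :=
    ((hasDerivAt_pow k p.2).div_const (k ! : ℝ)).comp_hasFDerivAt p hasFDerivAt_snd
  exact h2.smul h1

theorem continuousAt_ckTermDeriv [CompleteSpace V] (e : ι → E) (A : ι → V →L[ℝ] V) {f : E → V}
    (k : ℕ) {p : E × ℝ} (hf : AnalyticAt ℝ f p.1) :
    ContinuousAt (ckTermDeriv e A f k) p := by
  have h1 : ContinuousAt (fun p : E × ℝ => powDirac e A f k p.1) p :=
    ContinuousAt.comp (f := Prod.fst) (continuousAt_powDirac e A k hf) continuousAt_fst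
  have h2 : ContinuousAt (fun p : E × ℝ => powDiracDeriv e A f k p.1) p :=
    ContinuousAt.comp (f := Prod.fst) (continuousAt_powDiracDeriv e A k hf) continuousAt_fst
  have h3 : ContinuousAt (fun p : E × ℝ => p.2 ^ k / (k ! : ℝ)) p := by fun_prop
  have h4 : ContinuousAt (fun p : E × ℝ => (k * p.2 ^ (k - 1) / k ! : ℝ)) p := by fun_prop
  refine (h3.smul (h2.clm_comp continuousAt_const)).add ?_
  exact ((ContinuousLinearMap.smulRightL ℝ (E × ℝ) V).continuous₂.continuousAt).comp₂
    (h4.smul continuousAt_const) h1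

theorem norm_ckTermDeriv_le (e : ι → E) (A : ι → V →L[ℝ] V) {f : E → V} (k : ℕ) {p : E × ℝ}
    {C q : ℝ} (hC : 0 ≤ C) (hq : 0 < q) (h : ‖powDirac e A f k p.1‖ ≤ C * q ^ k * k !)
    (h' : ‖powDiracDeriv e A f k p.1‖ ≤ C * q ^ (k + 1) * (k + 1)!) (hp : |p.2| * q ≤ 1 / 2) :
    ‖ckTermDeriv e A f k p‖ ≤ C * q * (3 * k + 1) * (1 / 2) ^ k := by
  have hk : (0 : ℝ) < k ! := by positivity
  have hpow (j : ℕ) : |p.2| ^ j * q ^ j ≤ (1 / 2) ^ j := by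
    rw [← mul_pow]
    gcongr
  have e1 : ‖(p.2 ^ k / k !) • (powDiracDeriv e A f k p.1 ∘L ContinuousLinearMap.fst ℝ E ℝ)‖ ≤
      C * q * (k + 1) * (1 / 2) ^ k := by
    rw [norm_smul, norm_div, norm_pow, Real.norm_eq_abs, Real.norm_of_nonneg hk.le]
    calc _ ≤ |p.2| ^ k / k ! * (C * q ^ (k + 1) * (k + 1)! * 1) := by
          gcongr
          refine (ContinuousLinearMap.opNorm_comp_le _ _).trans ?_
          gcongr
          exact ContinuousLinearMap.norm_fst_le _ _ _
      _ = C * q * (k + 1) * (|p.2| ^ k * q ^ k) := by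
          rw [Nat.factorial_succ]
          push_cast
          field_simp
          ring
      _ ≤ _ := by gcongr; exact hpow k
  have e2 : ‖((k * p.2 ^ (k - 1) / k !) • ContinuousLinearMap.snd ℝ E ℝ).smulRight
      (powDirac e A f k p.1)‖ ≤ C * q * (2 * k) * (1 / 2) ^ k := by
    rw [ContinuousLinearMap.norm_smulRight_apply, norm_smul, norm_div, norm_mul, norm_pow,
      Real.norm_eq_abs p.2, Real.norm_of_nonneg hk.le, Real.norm_natCast]
    calc _ ≤ (k * |p.2| ^ (k - 1) / k ! * 1) * (C * q ^ k * k !) := by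
          gcongr
          exact ContinuousLinearMap.norm_snd_le _ _ _
      _ = C * k * (|p.2| ^ (k - 1) * q ^ k) := by field_simp
      _ ≤ _ := by
          rcases k with _ | k
          · simp
          · calc _ = C * (k + 1 : ℕ) * (|p.2| ^ k * q ^ k * q) := by
                  rw [Nat.add_sub_cancel, pow_succ]; ring
              _ ≤ C * (k + 1 : ℕ) * ((1 / 2) ^ k * q) := by gcongr; exact hpow k
              _ = _ := by rw [pow_succ]; ring
  calc _ ≤ _ := norm_add_le _ _
    _ ≤ _ := add_le_add e1 e2
    _ = _ := by ring

theorem ckTermDeriv_apply_zero_one (e : ι → E) (A : ι → V →L[ℝ] V) (f : E → V) (p : E × ℝ) :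
    ckTermDeriv e A f 0 p (0, 1) = 0 := by
  simp [ckTermDeriv]

theorem ckTermDeriv_succ_apply_zero_one (e : ι → E) (A : ι → V →L[ℝ] V) (f : E → V) (k : ℕ)
    (p : E × ℝ) :
    ckTermDeriv e A f (k + 1) p (0, 1) = ∑ i, A i (ckTermDeriv e A f k p (e i, 0)) := by
  have hc : ((k + 1 : ℕ) : ℝ) * p.2 ^ k / (k + 1)! = p.2 ^ k / k ! := by
    rw [Nat.factorial_succ]
    push_cast
    field_simp
  simp [ckTermDeriv, powDirac_succ, Finset.smul_sum, ← hc]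

theorem exists_cauchyKovalevskaya_extension [CompleteSpace V] (e : ι → E) (A : ι → V →L[ℝ] V)
    {Ω : Set E} {f : E → V} (hf : AnalyticOnNhd ℝ f Ω) :
    ∃ (U : Set (E × ℝ)) (F : E × ℝ → V), IsOpen U ∧ (∀ x ∈ Ω, (x, 0) ∈ U) ∧
      ContDiffOn ℝ 1 F U ∧ (∀ x, F (x, 0) = f x) ∧
      ∀ p ∈ U, fderiv ℝ F p (0, 1) = ∑ i, A i (fderiv ℝ F p (e i, 0)) := by
  set F : E × ℝ → V := fun p => ∑' k, ckTerm e A f k p with hF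
  have hF0 (x : E) : F (x, 0) = f x := by
    rw [hF]
    dsimp only
    rw [tsum_eq_single 0 fun k hk => by simp [ckTerm, hk]]
    simp [ckTerm, powDirac_zero]
  refine ⟨interior {p | ContDiffAt ℝ 1 F p ∧
    fderiv ℝ F p (0, 1) = ∑ i, A i (fderiv ℝ F p (e i, 0))}, F, isOpen_interior, ?_,
    fun p hp => (interior_subset hp).1.contDiffWithinAt, hF0, fun p hp => (interior_subset hp).2⟩
  intro x₀ hx₀
  rw [mem_interior_iff_mem_nhds]
  obtain ⟨C, q, hC, hq, hb⟩ := exists_norm_powDirac_le e A (hf x₀ hx₀)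
  obtain ⟨δ, hδ, hball⟩ := Metric.eventually_nhds_iff_ball.1 hb
  set s : Set (E × ℝ) := ball x₀ δ ×ˢ ball 0 (1 / (2 * q)) with hs
  have hso : IsOpen s := isOpen_ball.prod isOpen_ball
  have hsc : IsPreconnected s :=
    ((convex_ball x₀ δ).isPreconnected).prod (convex_ball 0 _).isPreconnected
  have hx₀s : (x₀, (0 : ℝ)) ∈ s := ⟨mem_ball_self hδ, mem_ball_self (by positivity)⟩
  set u : ℕ → ℝ := fun k => C * q * (3 * k + 1) * (1 / 2) ^ k with hu
  have hus : Summable u := by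
    have h1 := summable_pow_mul_geometric_of_norm_lt_one 1 (r := (1 / 2 : ℝ)) (by norm_num)
    have h0 := summable_pow_mul_geometric_of_norm_lt_one 0 (r := (1 / 2 : ℝ)) (by norm_num)
    refine ((h1.mul_left (C * q * 3)).add (h0.mul_left (C * q))).congr fun k => ?_
    simp only [hu, pow_one, pow_zero]
    ring
  have hd (k : ℕ) (p) (hp : p ∈ s) : HasFDerivAt (ckTerm e A f k) (ckTermDeriv e A f k p) p :=
    hasFDerivAt_ckTerm e A k (hball _ hp.1).1
  have hn (k : ℕ) (p) (hp : p ∈ s) : ‖ckTermDeriv e A f k p‖ ≤ u k := by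
    refine norm_ckTermDeriv_le e A k hC hq ((hball _ hp.1).2 k).1 ((hball _ hp.1).2 k).2 ?_
    have := hp.2
    rw [mem_ball_zero_iff, Real.norm_eq_abs] at this
    calc |p.2| * q ≤ 1 / (2 * q) * q := by gcongr
      _ = 1 / 2 := by field_simp
  have hs0 : Summable fun k => ckTerm e A f k (x₀, 0) :=
    summable_of_ne_finset_zero (s := {0}) fun k hk => by
      simp [ckTerm, show k ≠ 0 by simpa using hk]
  have hFd (p) (hp : p ∈ s) : HasFDerivAt F (∑' k, ckTermDeriv e A f k p) p :=
    hasFDerivAt_tsum_of_isPreconnected hus hso hsc hd hn hx₀s hs0 hp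
  have hFc : ContinuousOn (fun p => ∑' k, ckTermDeriv e A f k p) s :=
    continuousOn_tsum (fun k p hp =>
      (continuousAt_ckTermDeriv e A k (hball _ hp.1).1).continuousWithinAt) hus hn
  refine Filter.mem_of_superset (hso.mem_nhds hx₀s) fun p hp => ⟨?_, ?_⟩
  · exact contDiffAt_one_iff.2 ⟨_, s, hso.mem_nhds hp, hFc, hFd⟩
  · have hsum : Summable fun k => ckTermDeriv e A f k p :=
      Summable.of_norm_bounded hus fun k => hn k p hp
    have happ (v : E × ℝ) : fderiv ℝ F p v = ∑' k, ckTermDeriv e A f k p v := by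
      rw [(hFd p hp).fderiv]
      exact (ContinuousLinearMap.apply ℝ V v).map_tsum hsum
    have hsv (v : E × ℝ) : Summable fun k => ckTermDeriv e A f k p v :=
      Summable.of_norm_bounded (hus.mul_right ‖v‖) fun k =>
        ((ckTermDeriv e A f k p).le_opNorm v).trans
          (mul_le_mul_of_nonneg_right (hn k p hp) (norm_nonneg v))
    calc fderiv ℝ F p (0, 1) = ∑' k, ckTermDeriv e A f (k + 1) p (0, 1) := by
          rw [happ (0, 1), (hsv (0, 1)).tsum_eq_zero_add, ckTermDeriv_apply_zero_one, zero_add]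
      _ = ∑' k, ∑ i, A i (ckTermDeriv e A f k p (e i, 0)) :=
          tsum_congr fun k => ckTermDeriv_succ_apply_zero_one e A f k p
      _ = ∑ i, ∑' k, A i (ckTermDeriv e A f k p (e i, 0)) :=
          Summable.tsum_finsetSum fun i _ => (A i).summable (hsv (e i, 0))
      _ = ∑ i, A i (fderiv ℝ F p (e i, 0)) :=
          Finset.sum_congr rfl fun i _ => by
            rw [happ (e i, 0)]
            exact ((A i).map_tsum (hsv (e i, 0))).symm

end CauchyKovalevskaya

/-- A normalised smooth radial kernel on `ℝ^m`, supported in the closed unit ball. -/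
structure RadialKernel (m : ℕ) where
  /-- The kernel. -/
  ρ : (Fin m → ℝ) → ℝ
  /-- The radial profile of the gradient: `∇ρ(y) = ψ(y) y`. -/
  ψ : (Fin m → ℝ) → ℝ
  contDiff : ContDiff ℝ ∞ ρ
  continuous_ψ : Continuous ψ
  tsupport_subset : tsupport ρ ⊆ closedBall 0 1
  even : ∀ y, ρ (-y) = ρ y
  integral_eq_one : ∫ y, ρ y = 1
  fderiv_apply : ∀ y β, fderiv ℝ ρ y (Pi.single β 1) = ψ y * y β

namespace RadialKernel

theorem nonempty (m : ℕ) : Nonempty (RadialKernel m) := by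
  let η : ContDiffBump (0 : ℝ) := ⟨1 / 2, 1, by norm_num, by norm_num⟩
  let N : (Fin m → ℝ) → ℝ := fun y => ∑ i, y i ^ 2
  have hN : ContDiff ℝ ∞ N := by fun_prop
  let σ : (Fin m → ℝ) → ℝ := fun y => η (N y)
  have hη : ContDiff ℝ ∞ η := η.contDiff
  have hσ : ContDiff ℝ ∞ σ := hη.comp hN
  have hsupp : tsupport σ ⊆ closedBall 0 1 := by
    refine closure_minimal (fun y hy => ?_) isClosed_closedBall
    have hy' : N y ∈ Function.support η := hy
    rw [η.support_eq, mem_ball_zero_iff, Real.norm_eq_abs] at hy'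
    rw [mem_closedBall_zero_iff, pi_norm_le_iff_of_nonneg zero_le_one]
    intro i
    have h1 : y i ^ 2 ≤ N y := Finset.single_le_sum (f := fun i => y i ^ 2)
      (fun j _ => sq_nonneg _) (Finset.mem_univ i)
    rw [Real.norm_eq_abs, ← sq_le_one_iff_abs_le_one]
    exact h1.trans ((le_abs_self _).trans hy'.le)
  have hcs : HasCompactSupport σ := (isCompact_closedBall 0 1).of_isClosed_subset
    (isClosed_tsupport σ) hsupp
  have hpos : 0 < ∫ y, σ y := by
    refine hσ.continuous.integral_pos_of_hasCompactSupport_nonneg_nonzero hcs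
      (fun y => η.nonneg) (x := 0) ?_
    have : N 0 = 0 := by simp [N]
    simp only [σ, this]
    exact (η.pos_of_mem_ball (mem_ball_self η.rOut_pos)).ne'
  have hfd (y : Fin m → ℝ) (β : Fin m) :
      fderiv ℝ σ y (Pi.single β 1) = deriv η (N y) * (2 * y β) := by
    have h1 : HasFDerivAt N (∑ i, (2 * y i) •
        (ContinuousLinearMap.proj (R := ℝ) i : (Fin m → ℝ) →L[ℝ] ℝ)) y := by
      refine HasFDerivAt.fun_sum fun i _ => ?_
      simpa using
        (ContinuousLinearMap.proj (R := ℝ) i : (Fin m → ℝ) →L[ℝ] ℝ).hasFDerivAt.pow 2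
    have h2 : HasDerivAt η (deriv η (N y)) (N y) :=
      (hη.differentiable (by simp)).differentiableAt.hasDerivAt
    have h3 : HasFDerivAt σ _ y := h2.comp_hasFDerivAt y h1
    rw [h3.fderiv]
    simp [Pi.single_apply]
  refine ⟨⟨fun y => (∫ y, σ y)⁻¹ * σ y, fun y => (∫ y, σ y)⁻¹ * (deriv η (N y) * 2),
    contDiff_const.mul hσ, ?_, ?_, ?_, ?_, ?_⟩⟩
  · have : Continuous (deriv η) := hη.continuous_deriv (by simp)
    exact continuous_const.mul ((this.comp hN.continuous).mul continuous_const)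
  · exact (closure_mono (Function.support_mul_subset_right _ _)).trans hsupp
  · intro y
    simp [σ, N]
  · rw [integral_const_mul, inv_mul_cancel₀ hpos.ne']
  · intro y β
    rw [fderiv_const_mul (hσ.differentiable (by simp)).differentiableAt]
    simp only [FunLike.coe_smul, Pi.smul_apply, hfd, smul_eq_mul]
    ring

variable {m : ℕ} (κ : RadialKernel m)

theorem hasCompactSupport : HasCompactSupport κ.ρ :=
  (isCompact_closedBall 0 1).of_isClosed_subset (isClosed_tsupport _) κ.tsupport_subset

theorem mem_closedBall_of_ne_zero {y : Fin m → ℝ} (hy : κ.ρ y ≠ 0) : y ∈ closedBall 0 1 :=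
  κ.tsupport_subset (subset_tsupport _ hy)

theorem continuous : Continuous κ.ρ := κ.contDiff.continuous

variable {V : Type*} [NormedAddCommGroup V] [NormedSpace ℝ V]

theorem integrable_smul {h : (Fin m → ℝ) → V} (hh : Continuous h) :
    Integrable fun y => κ.ρ y • h y :=
  (κ.continuous.smul hh).integrable_of_hasCompactSupport κ.hasCompactSupport.smul_right

end RadialKernel

/-- The Dirac operator `∑ c_α ∂_α` attached to a family `c` of endomorphisms of `V`. -/
def diracOp {m : ℕ} {V : Type*} [NormedAddCommGroup V] [NormedSpace ℝ V]
    (c : Fin m → V →L[ℝ] V) (f : (Fin m → ℝ) → V) (X : Fin m → ℝ) : V :=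
  ∑ α, c α (fderiv ℝ f X (Pi.single α 1))

/-- The Clifford relations `c_α c_β + c_β c_α = -2 δ_{αβ}`. -/
def CliffordRel {m : ℕ} {V : Type*} [NormedAddCommGroup V] [NormedSpace ℝ V]
    (c : Fin m → V →L[ℝ] V) : Prop :=
  ∀ α β v, c α (c β v) + c β (c α v) = if α = β then (-2 : ℝ) • v else 0

section MeanValue

variable {m : ℕ} {V : Type*} [NormedAddCommGroup V] [NormedSpace ℝ V] {c : Fin m → V →L[ℝ] V}

theorem CliffordRel.sum_diag_eq_zero (hc : CliffordRel c) {T : Fin m → Fin m → V}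
    (hT : ∀ α β, T α β = T β α) (h0 : ∑ α, ∑ β, c α (c β (T α β)) = 0) : ∑ α, T α α = 0 := by
  have h1 : ∑ α, ∑ β, c β (c α (T α β)) = 0 := by
    rw [Finset.sum_comm, ← h0]
    exact Finset.sum_congr rfl fun α _ => Finset.sum_congr rfl fun β _ => by rw [hT]
  have h2 : ∑ α, ∑ β, (c α (c β (T α β)) + c β (c α (T α β))) = 0 := by
    simp_rw [Finset.sum_add_distrib, h0, h1, add_zero]
  simp_rw [hc _ _ _] at h2
  simp only [Finset.sum_ite_eq, Finset.mem_univ, if_true, ← Finset.smul_sum] at h2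
  exact (smul_eq_zero.1 h2).resolve_left (by norm_num)

variable [CompleteSpace V]

theorem RadialKernel.integral_smul_fderiv_self_eq_zero (κ : RadialKernel m) (hc : CliffordRel c)
    {g : (Fin m → ℝ) → V} (hg : ContDiff ℝ 1 g)
    (hgd : ∀ y ∈ closedBall (0 : Fin m → ℝ) 1, diracOp c g y = 0) :
    ∫ y, κ.ρ y • fderiv ℝ g y y = 0 := by
  have hg' : Continuous (fderiv ℝ g) := hg.continuous_fderiv (by simp)
  have hg'v (β : Fin m) : Continuous fun y => fderiv ℝ g y (Pi.single β 1) :=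
    hg'.clm_apply continuous_const
  set T : Fin m → Fin m → V := fun α β => ∫ y, κ.ρ y • y α • fderiv ℝ g y (Pi.single β 1) with hTd
  have hint (α β : Fin m) : Integrable fun y => κ.ρ y • y α • fderiv ℝ g y (Pi.single β 1) :=
    κ.integrable_smul ((continuous_apply α).smul (hg'v β))
  have hTeq (α β : Fin m) : T α β =
      -∫ y, (y α * (κ.ψ y * y β) + κ.ρ y * (if α = β then 1 else 0)) • g y := by
    have hρd : Differentiable ℝ κ.ρ := κ.contDiff.differentiable (by simp)
    have hd (y : Fin m → ℝ) : HasFDerivAt (fun y => y α * κ.ρ y)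
        (y α • fderiv ℝ κ.ρ y + κ.ρ y • ContinuousLinearMap.proj (R := ℝ) α) y :=
      (ContinuousLinearMap.proj (R := ℝ) α : (Fin m → ℝ) →L[ℝ] ℝ).hasFDerivAt.mul
        (hρd y).hasFDerivAt
    have hdv (y : Fin m → ℝ) : fderiv ℝ (fun y => y α * κ.ρ y) y (Pi.single β 1) =
        y α * (κ.ψ y * y β) + κ.ρ y * (if α = β then 1 else 0) := by
      rw [(hd y).fderiv]
      simp [κ.fderiv_apply, Pi.single_apply]
    have hcs : HasCompactSupport fun y => y α * κ.ρ y := κ.hasCompactSupport.mul_left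
    have hcont : Continuous fun y => y α * κ.ρ y := (continuous_apply α).mul κ.continuous
    have hcont' : Continuous fun y => fderiv ℝ (fun y => y α * κ.ρ y) y (Pi.single β 1) := by
      simp_rw [hdv]
      have := κ.continuous_ψ
      have := κ.continuous
      fun_prop
    have key := integral_smul_fderiv_eq_neg_fderiv_smul_of_integrable (μ := volume) (𝕜 := ℝ)
      (f := fun y => y α * κ.ρ y) (g := g) (v := Pi.single β 1)
      ((hcont'.smul hg.continuous).integrable_of_hasCompactSupport
        (hcs.fderiv_apply ℝ _).smul_right)
      ((hcont.smul (hg'v β)).integrable_of_hasCompactSupport hcs.smul_right)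
      ((hcont.smul hg.continuous).integrable_of_hasCompactSupport hcs.smul_right)
      (fun y _ => (hd y).differentiableAt)
      (fun y _ => (hg.differentiable (by simp)).differentiableAt)
    simp_rw [hdv] at key
    rw [← key]
    exact integral_congr_ae (ae_of_all _ fun y => by simp only [smul_smul, mul_comm])
  have hTsymm (α β : Fin m) : T α β = T β α := by
    rw [hTeq, hTeq]
    congr 1
    refine integral_congr_ae (ae_of_all _ fun y => ?_)
    simp only [eq_comm (a := α) (b := β)]
    congr 2
    ring
  have hsum : ∑ α, ∑ β, c α (c β (T α β)) = 0 := by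
    have h1 (α β : Fin m) : c α (c β (T α β)) =
        ∫ y, κ.ρ y • y α • c α (c β (fderiv ℝ g y (Pi.single β 1))) := by
      have := (c α ∘L c β).integral_comp_comm (hint α β)
      simp only [ContinuousLinearMap.comp_apply, map_smul] at this
      exact this.symm
    have hci (α β : Fin m) : Integrable fun y =>
        κ.ρ y • y α • c α (c β (fderiv ℝ g y (Pi.single β 1))) :=
      κ.integrable_smul ((continuous_apply α).smul
        ((c α).continuous.comp ((c β).continuous.comp (hg'v β))))
    simp_rw [h1]
    rw [Finset.sum_congr rfl fun α _ => (integral_finsetSum _ fun β _ => hci α β).symm,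
      ← integral_finsetSum _ fun α _ => integrable_finsetSum _ fun β _ => hci α β]
    refine integral_eq_zero_of_ae (ae_of_all _ fun y => ?_)
    by_cases hy : κ.ρ y = 0
    · simp [hy]
    · have := hgd y (κ.mem_closedBall_of_ne_zero hy)
      rw [diracOp] at this
      simp only [← Finset.smul_sum, ← map_sum, this, map_zero, smul_zero, Finset.sum_const_zero,
        Pi.zero_apply]
  rw [← hc.sum_diag_eq_zero hTsymm hsum, hTd, ← integral_finsetSum _ fun α _ => hint α α]
  refine integral_congr_ae (ae_of_all _ fun y => ?_)
  simp only [← Finset.smul_sum]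
  congr 1
  have h (L : (Fin m → ℝ) →L[ℝ] V) : ∑ α, y α • L (Pi.single α 1) = L y := by
    conv_rhs => rw [pi_eq_sum_univ' y]
    simp
  exact (h _).symm

end MeanValue

section MeanValueProperty

variable {m : ℕ} {V : Type*} [NormedAddCommGroup V] [NormedSpace ℝ V] {c : Fin m → V →L[ℝ] V}

theorem sub_smul_mem_closedBall {X y : Fin m → ℝ} {δ : ℝ} (hδ : 0 ≤ δ)
    (hy : y ∈ closedBall (0 : Fin m → ℝ) 1) : X - δ • y ∈ closedBall X δ := by
  rw [mem_closedBall_zero_iff] at hy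
  rw [mem_closedBall, dist_eq_norm, sub_sub_cancel_left, norm_neg, norm_smul,
    Real.norm_of_nonneg hδ]
  exact mul_le_of_le_one_right hδ hy

theorem fderiv_comp_sub_smul {f : (Fin m → ℝ) → V} (hf : Differentiable ℝ f)
    (X : Fin m → ℝ) (s : ℝ) (y v : Fin m → ℝ) :
    fderiv ℝ (fun y => f (X - s • y)) y v = -(s • fderiv ℝ f (X - s • y) v) := by
  have h1 : HasFDerivAt (fun y : Fin m → ℝ => X - s • y)
      (-(s • ContinuousLinearMap.id ℝ (Fin m → ℝ))) y :=
    ((hasFDerivAt_id y).const_smul s).const_sub X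
  have h2 : HasFDerivAt (fun y => f (X - s • y)) _ y := (hf (X - s • y)).hasFDerivAt.comp y h1
  rw [h2.fderiv]
  simp

theorem RadialKernel.integral_smul_odd_eq_zero (κ : RadialKernel m) (L : (Fin m → ℝ) →L[ℝ] V) :
    ∫ y, κ.ρ y • L y = 0 := by
  have h := integral_neg_eq_self (fun y => κ.ρ y • L y) volume
  simp only [κ.even, map_neg, smul_neg, integral_neg] at h
  have h2 : (2 : ℝ) • ∫ y, κ.ρ y • L y = 0 := by
    rw [two_smul]
    nth_rewrite 1 [← h]
    simp
  exact (smul_eq_zero.1 h2).resolve_left two_ne_zero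

theorem RadialKernel.hasDerivAt_integral (κ : RadialKernel m) {f : (Fin m → ℝ) → V}
    (hf : ContDiff ℝ 1 f) (X : Fin m → ℝ) (s : ℝ) :
    HasDerivAt (fun s : ℝ => ∫ y, κ.ρ y • f (X - s • y))
      (∫ y, κ.ρ y • -(fderiv ℝ f (X - s • y) y)) s := by
  have hf' : Continuous (fderiv ℝ f) := hf.continuous_fderiv (by simp)
  have hcont : Continuous fun p : ℝ × (Fin m → ℝ) =>
      κ.ρ p.2 • -(fderiv ℝ f (X - p.1 • p.2) p.2) := by
    have h1 : Continuous fun p : ℝ × (Fin m → ℝ) => κ.ρ p.2 := κ.continuous.comp continuous_snd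
    have h2 : Continuous fun p : ℝ × (Fin m → ℝ) => fderiv ℝ f (X - p.1 • p.2) :=
      hf'.comp (by fun_prop)
    exact h1.smul (h2.clm_apply continuous_snd).neg
  obtain ⟨B, hB⟩ := ((isCompact_closedBall s 1).prod
    (isCompact_closedBall (0 : Fin m → ℝ) 1)).exists_bound_of_continuousOn hcont.continuousOn
  refine (hasDerivAt_integral_of_dominated_loc_of_deriv_le (μ := volume)
    (bound := (closedBall (0 : Fin m → ℝ) 1).indicator fun _ => B)
    (F' := fun s y => κ.ρ y • -(fderiv ℝ f (X - s • y) y))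
    (closedBall_mem_nhds s zero_lt_one) ?_ ?_ ?_ ?_ ?_ ?_).2
  · refine Eventually.of_forall fun s => Continuous.aestronglyMeasurable ?_
    exact κ.continuous.smul (hf.continuous.comp (by fun_prop))
  · exact κ.integrable_smul (hf.continuous.comp (by fun_prop))
  · exact (hcont.comp (by fun_prop : Continuous fun y : Fin m → ℝ => (s, y))).aestronglyMeasurable
  · refine ae_of_all _ fun y t ht => ?_
    by_cases hy : y ∈ closedBall (0 : Fin m → ℝ) 1
    · rw [indicator_of_mem hy]
      exact hB (t, y) ⟨ht, hy⟩
    · rw [indicator_of_notMem hy]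
      have : κ.ρ y = 0 := by
        by_contra h
        exact hy (κ.mem_closedBall_of_ne_zero h)
      simp [this]
  · exact (integrable_indicator_iff measurableSet_closedBall).2
      (integrableOn_const (measure_closedBall_lt_top).ne)
  · refine ae_of_all _ fun y t _ => ?_
    have h1 : HasDerivAt (fun t : ℝ => X - t • y) (-y) t := by
      simpa using ((hasDerivAt_id t).smul_const y).const_sub X
    have h2 := ((hf.differentiable (by simp)) (X - t • y)).hasFDerivAt.comp_hasDerivAt t h1
    rw [map_neg] at h2
    exact h2.const_smul (κ.ρ y)

variable [CompleteSpace V]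

theorem RadialKernel.integral_smul_eq_self (κ : RadialKernel m) (hc : CliffordRel c)
    {f : (Fin m → ℝ) → V} (hf : ContDiff ℝ 1 f) {X : Fin m → ℝ} {δ : ℝ} (hδ : 0 ≤ δ)
    (hfd : ∀ Y ∈ closedBall X δ, diracOp c f Y = 0) :
    ∫ y, κ.ρ y • f (X - δ • y) = f X := by
  have hzero (s : ℝ) (hs : s ∈ Icc 0 δ) : ∫ y, κ.ρ y • -(fderiv ℝ f (X - s • y) y) = 0 := by
    rcases hs.1.eq_or_lt with rfl | hs0
    · simpa [integral_neg] using κ.integral_smul_odd_eq_zero (fderiv ℝ f X)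
    have hg : ContDiff ℝ 1 fun y => f (X - s • y) := hf.comp (by fun_prop)
    have hgf := fderiv_comp_sub_smul (hf.differentiable (by simp)) X s
    have h := κ.integral_smul_fderiv_self_eq_zero hc hg (fun y hy => ?_)
    · simp_rw [hgf, ← smul_neg, smul_comm _ s, integral_smul] at h
      exact (smul_eq_zero.1 h).resolve_left hs0.ne'
    · have h := hfd _ (closedBall_subset_closedBall hs.2 (sub_smul_mem_closedBall hs0.le hy))
      rw [diracOp] at h ⊢
      simp only [hgf, map_neg, map_smul, Finset.sum_neg_distrib, ← Finset.smul_sum, h, smul_zero,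
        neg_zero]
  have hI := constant_of_has_deriv_right_zero
    (f := fun s : ℝ => ∫ y, κ.ρ y • f (X - s • y)) (a := 0) (b := δ)
    (fun s _ => (κ.hasDerivAt_integral hf X s).continuousAt.continuousWithinAt)
    (fun s hs => by
      have h := κ.hasDerivAt_integral hf X s
      rw [hzero s (Ico_subset_Icc_self hs)] at h
      exact h.hasDerivWithinAt) δ (right_mem_Icc.2 hδ)
  simp only [zero_smul, sub_zero] at hI
  rw [hI, integral_smul_const, κ.integral_eq_one, one_smul]

end MeanValueProperty

section GradientEstimate

variable {m : ℕ} {V : Type*} [NormedAddCommGroup V] [NormedSpace ℝ V] {c : Fin m → V →L[ℝ] V}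

theorem diracOp_congr_of_eventuallyEq {f g : (Fin m → ℝ) → V} {X : Fin m → ℝ}
    (h : f =ᶠ[𝓝 X] g) : diracOp c f X = diracOp c g X := by
  simp only [diracOp, h.fderiv_eq]

/-- A `C¹` monogenic function is smooth: near the centre of a ball it agrees with a globally
smooth function. -/
theorem RadialKernel.exists_contDiff_eqOn [CompleteSpace V] (κ : RadialKernel m)
    (hc : CliffordRel c) {f : (Fin m → ℝ) → V} (hf : ContDiff ℝ 1 f) {X₀ : Fin m → ℝ} {δ : ℝ}
    (hδ : 0 < δ) (hfd : ∀ Y ∈ closedBall X₀ (2 * δ), diracOp c f Y = 0) :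
    ∃ G : (Fin m → ℝ) → V, ContDiff ℝ ∞ G ∧ EqOn G f (closedBall X₀ δ) := by
  let σ : (Fin m → ℝ) → ℝ := fun y => |(δ⁻¹ ^ m)| * κ.ρ (δ⁻¹ • y)
  have hσ : ContDiff ℝ ∞ σ := contDiff_const.mul (κ.contDiff.comp (by fun_prop))
  have hσc : HasCompactSupport σ :=
    (κ.hasCompactSupport.comp_smul (inv_ne_zero hδ.ne')).mul_left
  refine ⟨convolution σ f (ContinuousLinearMap.lsmul ℝ ℝ) volume,
    hσc.contDiff_convolution_left _ hσ hf.continuous.locallyIntegrable, fun X hX => ?_⟩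
  have h1 : ∫ y, κ.ρ y • f (X - δ • y) = f X := by
    refine κ.integral_smul_eq_self hc hf hδ.le fun Y hY => hfd Y ?_
    rw [mem_closedBall] at *
    linarith [dist_triangle Y X X₀]
  have h2 := Measure.integral_comp_smul volume (fun y => κ.ρ (δ⁻¹ • y) • f (X - y)) δ
  simp only [inv_smul_smul₀ hδ.ne', h1, Module.finrank_fin_fun] at h2
  rw [h2, convolution_def, ← integral_smul]
  simp [σ, smul_smul]

variable (v : Fin m → ℝ)

/-- The directional derivative `∂_v f`. -/
def dirD (f : (Fin m → ℝ) → V) : (Fin m → ℝ) → V := fun X => fderiv ℝ f X v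

variable {v}

theorem contDiff_dirD {f : (Fin m → ℝ) → V} (hf : ContDiff ℝ ∞ f) : ContDiff ℝ ∞ (dirD v f) :=
  (hf.fderiv_right (m := ∞) (by simp)).clm_apply contDiff_const

theorem contDiff_dirD_iterate {f : (Fin m → ℝ) → V} (hf : ContDiff ℝ ∞ f) (k : ℕ) :
    ContDiff ℝ ∞ ((dirD v)^[k] f) := by
  induction k with
  | zero => exact hf
  | succ k ih => rw [Function.iterate_succ_apply']; exact contDiff_dirD ih

theorem diracOp_dirD_eq_zero {f : (Fin m → ℝ) → V} (hf : ContDiff ℝ ∞ f) {U : Set (Fin m → ℝ)}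
    (hU : IsOpen U) (hfd : ∀ X ∈ U, diracOp c f X = 0) :
    ∀ X ∈ U, diracOp c (dirD v f) X = 0 := by
  intro X hX
  have hf' : Differentiable ℝ (fderiv ℝ f) :=
    (hf.fderiv_right (m := ∞) (by simp)).differentiable (by simp)
  have hd (w : Fin m → ℝ) : HasFDerivAt (fun Y => fderiv ℝ f Y w)
      ((fderiv ℝ (fderiv ℝ f) X).flip w) X := by
    simpa using (hf' X).hasFDerivAt.clm_apply (hasFDerivAt_const w X)
  have h0 : HasFDerivAt (diracOp c f) (0 : (Fin m → ℝ) →L[ℝ] V) X := by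
    refine (hasFDerivAt_const (0 : V) X).congr_of_eventuallyEq ?_
    filter_upwards [hU.mem_nhds hX] with Y hY using hfd Y hY
  have h1 : HasFDerivAt (diracOp c f)
      (∑ α, c α ∘L ((fderiv ℝ (fderiv ℝ f) X).flip (Pi.single α 1))) X :=
    HasFDerivAt.fun_sum fun α _ => (c α).hasFDerivAt.comp X (hd _)
  have h2 := DFunLike.congr_fun (h1.unique h0) v
  have hsymm : IsSymmSndFDerivAt ℝ f X := ((hf.contDiffAt (x := X)).of_le
    (WithTop.coe_le_coe.2 (le_top : (2 : ℕ∞) ≤ ⊤))).isSymmSndFDerivAt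
      (n := 2) (by simp)
  simp only [FunLike.coe_sum, Finset.sum_apply, ContinuousLinearMap.comp_apply,
    ContinuousLinearMap.flip_apply, FunLike.coe_zero, Pi.zero_apply] at h2
  rw [diracOp, ← h2]
  refine Finset.sum_congr rfl fun α _ => ?_
  have h3 : HasFDerivAt (dirD v f) _ X := hd v
  rw [h3.fderiv, ContinuousLinearMap.flip_apply, hsymm]

theorem diracOp_dirD_iterate_eq_zero {f : (Fin m → ℝ) → V} (hf : ContDiff ℝ ∞ f)
    {U : Set (Fin m → ℝ)} (hU : IsOpen U) (hfd : ∀ X ∈ U, diracOp c f X = 0) (k : ℕ) :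
    ∀ X ∈ U, diracOp c ((dirD v)^[k] f) X = 0 := by
  induction k with
  | zero => exact hfd
  | succ k ih =>
    rw [Function.iterate_succ_apply']
    exact diracOp_dirD_eq_zero (contDiff_dirD_iterate hf k) hU ih

variable [CompleteSpace V]

theorem RadialKernel.norm_dirD_le (κ : RadialKernel m) (hc : CliffordRel c)
    {f : (Fin m → ℝ) → V} (hf : ContDiff ℝ ∞ f) {X : Fin m → ℝ} {δ M : ℝ} (hδ : 0 < δ)
    (hfd : ∀ Y ∈ closedBall X δ, diracOp c (dirD v f) Y = 0)
    (hM : ∀ Y ∈ closedBall X δ, ‖f Y‖ ≤ M) :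
    ‖dirD v f X‖ ≤ (∫ y, ‖fderiv ℝ κ.ρ y v‖) / δ * M := by
  have hρ' : Continuous fun y => fderiv ℝ κ.ρ y v :=
    (κ.contDiff.continuous_fderiv (by simp)).clm_apply continuous_const
  have hρc : HasCompactSupport fun y => fderiv ℝ κ.ρ y v := κ.hasCompactSupport.fderiv_apply ℝ v
  have hg : ContDiff ℝ ∞ fun y => f (X - δ • y) := hf.comp (by fun_prop)
  have hgv : Continuous fun y => fderiv ℝ (fun y => f (X - δ • y)) y v :=
    (hg.continuous_fderiv (by simp)).clm_apply continuous_const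
  have h1 := κ.integral_smul_eq_self hc ((contDiff_dirD (v := v) hf).of_le (by simp)) hδ.le hfd
  have h2 := integral_smul_fderiv_eq_neg_fderiv_smul_of_integrable (μ := volume) (𝕜 := ℝ)
    (f := κ.ρ) (g := fun y => f (X - δ • y)) (v := v)
    ((hρ'.smul hg.continuous).integrable_of_hasCompactSupport hρc.smul_right)
    (κ.integrable_smul hgv) (κ.integrable_smul hg.continuous)
    (fun y _ => (κ.contDiff.differentiable (by simp)) y)
    (fun y _ => (hg.differentiable (by simp)) y)
  simp_rw [fderiv_comp_sub_smul (hf.differentiable (by simp)), smul_neg, integral_neg,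
    smul_comm _ δ, integral_smul, neg_inj] at h2
  have h3 : dirD v f X = δ⁻¹ • ∫ y, fderiv ℝ κ.ρ y v • f (X - δ • y) := by
    rw [← h2, inv_smul_smul₀ hδ.ne', ← h1]
    rfl
  have h4 : ‖∫ y, fderiv ℝ κ.ρ y v • f (X - δ • y)‖ ≤ ∫ y, ‖fderiv ℝ κ.ρ y v‖ * M := by
    refine norm_integral_le_of_norm_le
      ((hρ'.norm.integrable_of_hasCompactSupport hρc.norm).mul_const M) (ae_of_all _ fun y => ?_)
    rw [norm_smul]
    by_cases hy : fderiv ℝ κ.ρ y v = 0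
    · simp [hy]
    · have hy' : y ∈ closedBall (0 : Fin m → ℝ) 1 := by
        refine κ.tsupport_subset (support_fderiv_subset ℝ fun h => hy ?_)
        simp [h]
      exact mul_le_mul_of_nonneg_left (hM _ (sub_smul_mem_closedBall hδ.le hy')) (norm_nonneg _)
  rw [h3, norm_smul, norm_inv, Real.norm_of_nonneg hδ.le]
  rw [integral_mul_const] at h4
  calc δ⁻¹ * ‖∫ y, fderiv ℝ κ.ρ y v • f (X - δ • y)‖
      ≤ δ⁻¹ * ((∫ y, ‖fderiv ℝ κ.ρ y v‖) * M) := by gcongr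
    _ = _ := by ring

theorem RadialKernel.norm_dirD_iterate_le (κ : RadialKernel m) (hc : CliffordRel c)
    {f : (Fin m → ℝ) → V} (hf : ContDiff ℝ ∞ f) {U : Set (Fin m → ℝ)} (hU : IsOpen U)
    (hfd : ∀ Y ∈ U, diracOp c f Y = 0) {δ M : ℝ} (hδ : 0 < δ) (k : ℕ) {X : Fin m → ℝ}
    (hXU : closedBall X (k * δ) ⊆ U) (hM : ∀ Y ∈ closedBall X (k * δ), ‖f Y‖ ≤ M) :
    ‖(dirD v)^[k] f X‖ ≤ ((∫ y, ‖fderiv ℝ κ.ρ y v‖) / δ) ^ k * M := by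
  induction k generalizing X with
  | zero => simpa using hM X (by simp)
  | succ k ih =>
    have hsub {Y : Fin m → ℝ} (hY : Y ∈ closedBall X δ) :
        closedBall Y (k * δ) ⊆ closedBall X ((k + 1 : ℕ) * δ) := by
      refine closedBall_subset_closedBall' ?_
      rw [mem_closedBall] at hY
      push_cast
      linarith
    rw [Function.iterate_succ_apply', pow_succ', mul_assoc]
    refine κ.norm_dirD_le hc (contDiff_dirD_iterate hf k) hδ (fun Y hY => ?_) fun Y hY => ?_
    · exact diracOp_dirD_eq_zero (contDiff_dirD_iterate hf k) hU
        (diracOp_dirD_iterate_eq_zero hf hU hfd k) Y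
        (hXU (hsub hY (mem_closedBall_self (by positivity))))
    · exact ih ((hsub hY).trans hXU) fun Z hZ => hM Z (hsub hY hZ)

end GradientEstimate

section Uniqueness

variable {m : ℕ} {V : Type*} [NormedAddCommGroup V] [NormedSpace ℝ V] {c : Fin m → V →L[ℝ] V}

theorem norm_le_mul_pow_div_factorial_of_nonneg {φ : ℕ → ℝ → V} {a B : ℝ}
    (hφ : ∀ k t, HasDerivAt (φ k) (φ (k + 1) t) t) (h0 : ∀ k, φ k 0 = 0) (n : ℕ)
    (hB : ∀ t ∈ Icc 0 a, ‖φ n t‖ ≤ B) :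
    ∀ t ∈ Icc 0 a, ‖φ 0 t‖ ≤ B * (t ^ n / n.factorial) := by
  induction n generalizing φ with
  | zero => simpa using hB
  | succ n ih =>
    have h1 := ih (φ := fun k => φ (k + 1)) (fun k t => hφ (k + 1) t) (fun k => h0 (k + 1)) hB
    intro t ht
    have hd (x : ℝ) : HasDerivAt (fun t : ℝ => B * (t ^ (n + 1) / ((n + 1).factorial : ℝ)))
        (B * (x ^ n / n.factorial)) x := by
      have h2 := ((hasDerivAt_pow (n + 1) x).div_const ((n + 1).factorial : ℝ)).const_mul B
      refine h2.congr_deriv ?_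
      have : (n.factorial : ℝ) ≠ 0 := by positivity
      rw [Nat.factorial_succ]
      push_cast
      field_simp
    exact image_norm_le_of_norm_deriv_right_le_deriv_boundary
      (f := φ 0) (f' := φ 1) (a := 0) (b := a)
      (fun x _ => (hφ 0 x).continuousAt.continuousWithinAt)
      (fun x _ => (hφ 0 x).hasDerivWithinAt) (by simp [h0]) hd
      (fun x hx => h1 x (Ico_subset_Icc_self hx)) ht

theorem norm_le_mul_abs_pow_div_factorial {φ : ℕ → ℝ → V} {a B : ℝ}
    (hφ : ∀ k t, HasDerivAt (φ k) (φ (k + 1) t) t) (h0 : ∀ k, φ k 0 = 0) (n : ℕ)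
    (hB : ∀ t, |t| ≤ a → ‖φ n t‖ ≤ B) {t : ℝ} (ht : |t| ≤ a) :
    ‖φ 0 t‖ ≤ B * (|t| ^ n / n.factorial) := by
  rcases le_total 0 t with h | h
  · rw [abs_of_nonneg h] at ht ⊢
    exact norm_le_mul_pow_div_factorial_of_nonneg hφ h0 n
      (fun s hs => hB s (by rw [abs_of_nonneg hs.1]; exact hs.2)) t ⟨h, ht⟩
  · rw [abs_of_nonpos h] at ht ⊢
    have := norm_le_mul_pow_div_factorial_of_nonneg (a := a) (B := B)
      (φ := fun k s => (-1 : ℝ) ^ k • φ k (-s)) (fun k s => ?_) (fun k => by simp [h0]) n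
      (fun s hs => ?_) (-t) ⟨neg_nonneg.2 h, ht⟩
    · simpa using this
    · have := ((hφ k (-s)).scomp s (hasDerivAt_neg s)).const_smul ((-1 : ℝ) ^ k)
      refine this.congr_deriv ?_
      simp [pow_succ]
    · rw [norm_smul, norm_pow, norm_neg, norm_one, one_pow, one_mul]
      exact hB _ (by rw [abs_neg, abs_of_nonneg hs.1]; exact hs.2)

theorem fderiv_single_eq_zero_of_forall_mem {f : (Fin m → ℝ) → V} (hc : CliffordRel c)
    {l : Fin m} {U : Set (Fin m → ℝ)} (hU : IsOpen U) (hf : ContDiff ℝ ∞ f)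
    (hfd : ∀ X ∈ U, diracOp c f X = 0) (h0 : ∀ X ∈ U, X l = 0 → f X = 0) :
    ∀ X ∈ U, X l = 0 → dirD (Pi.single l 1) f X = 0 := by
  intro X hX hXl
  have htan (α : Fin m) (hα : α ≠ l) : fderiv ℝ f X (Pi.single α 1) = 0 := by
    have h1 : HasDerivAt (fun t : ℝ => X + t • (Pi.single α 1 : Fin m → ℝ)) (Pi.single α 1) 0 := by
      simpa using ((hasDerivAt_id (0 : ℝ)).smul_const (Pi.single α 1 : Fin m → ℝ)).const_add X
    have hX0 : X = X + (0 : ℝ) • (Pi.single α 1 : Fin m → ℝ) := by simp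
    have h2 : HasDerivAt (fun t : ℝ => f (X + t • (Pi.single α 1 : Fin m → ℝ)))
        (fderiv ℝ f X (Pi.single α 1)) 0 := by
      have := (hf.differentiable (by simp) X).hasFDerivAt
      nth_rewrite 2 [hX0] at this
      exact this.comp_hasDerivAt (0 : ℝ) h1
    refine h2.unique ((hasDerivAt_const (0 : ℝ) (0 : V)).congr_of_eventuallyEq ?_)
    have hmem : ∀ᶠ t : ℝ in 𝓝 0, X + t • (Pi.single α 1 : Fin m → ℝ) ∈ U :=
      h1.continuousAt.eventually_mem (hU.mem_nhds (by simpa using hX))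
    filter_upwards [hmem] with t ht
    exact h0 _ ht (by simp [hXl, hα.symm])
  have h1 := hfd X hX
  rw [diracOp, Finset.sum_eq_single l (fun α _ hα => by rw [htan α hα, map_zero])
    (fun h => absurd (Finset.mem_univ l) h)] at h1
  have h2 := hc l l (fderiv ℝ f X (Pi.single l 1))
  rw [h1, map_zero, add_zero, if_pos rfl] at h2
  exact (smul_eq_zero.1 h2.symm).resolve_left (by norm_num)

variable [CompleteSpace V]

theorem eventually_eq_zero_of_contDiff (hc : CliffordRel c) {f : (Fin m → ℝ) → V}
    (hf : ContDiff ℝ ∞ f) {l : Fin m} {X₀ : Fin m → ℝ} (hX₀ : X₀ l = 0) {r : ℝ} (hr : 0 < r)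
    (hfd : ∀ X ∈ ball X₀ (3 * r), diracOp c f X = 0)
    (h0 : ∀ X ∈ ball X₀ (3 * r), X l = 0 → f X = 0) : ∀ᶠ X in 𝓝 X₀, f X = 0 := by
  obtain ⟨κ⟩ := RadialKernel.nonempty m
  set e : Fin m → ℝ := Pi.single l 1
  set C : ℝ := ∫ y, ‖fderiv ℝ κ.ρ y e‖
  have hC : 0 ≤ C := integral_nonneg fun y => norm_nonneg _
  obtain ⟨M, hM⟩ := (isCompact_closedBall X₀ (2 * r)).exists_bound_of_continuousOn
    hf.continuous.continuousOn
  have hbound (n : ℕ) (hn : 0 < n) {X : Fin m → ℝ} (hX : X ∈ closedBall X₀ r) :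
      ‖(dirD e)^[n] f X‖ ≤ (C / (r / n)) ^ n * M := by
    have hn' : (n : ℝ) * (r / n) = r := by field_simp
    have hsub : closedBall X (n * (r / n)) ⊆ closedBall X₀ (2 * r) := by
      refine closedBall_subset_closedBall' ?_
      rw [mem_closedBall] at hX
      rw [hn']
      linarith
    exact κ.norm_dirD_iterate_le hc hf isOpen_ball hfd (by positivity) n
      (hsub.trans (closedBall_subset_ball (by linarith))) fun Y hY => hM Y (hsub hY)
  have hvan (k : ℕ) : ∀ X ∈ ball X₀ (3 * r), X l = 0 → (dirD e)^[k] f X = 0 := by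
    induction k with
    | zero => exact h0
    | succ k ih =>
      rw [Function.iterate_succ_apply']
      exact fderiv_single_eq_zero_of_forall_mem hc isOpen_ball (contDiff_dirD_iterate hf k)
        (diracOp_dirD_iterate_eq_zero hf isOpen_ball hfd k) ih
  have hq : ∀ᶠ X : Fin m → ℝ in 𝓝 X₀, Real.exp 1 * C * |X l| / r < 1 := by
    have : Continuous fun X : Fin m → ℝ => Real.exp 1 * C * |X l| / r := by fun_prop
    exact this.continuousAt.eventually_lt continuousAt_const (by simp [hX₀])
  filter_upwards [hq, closedBall_mem_nhds X₀ hr] with X hXq hXr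
  have hcoord (i : Fin m) : |X i - X₀ i| ≤ r := by
    rw [mem_closedBall, dist_eq_norm] at hXr
    exact (norm_le_pi_norm (X - X₀) i).trans hXr
  have hupd {t : ℝ} (ht : |t| ≤ r) : X + (t - X l) • e ∈ closedBall X₀ r := by
    rw [mem_closedBall, dist_eq_norm, pi_norm_le_iff_of_nonneg hr.le]
    intro i
    rcases eq_or_ne i l with rfl | hi
    · simpa [e, hX₀] using ht
    · simpa [e, Pi.single_apply, hi] using hcoord i
  have hXl : |X l| ≤ r := by simpa [hX₀] using hcoord l
  have hderiv (k : ℕ) (t : ℝ) : HasDerivAt (fun t : ℝ => (dirD e)^[k] f (X + (t - X l) • e))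
      ((dirD e)^[k + 1] f (X + (t - X l) • e)) t := by
    have h1 : HasDerivAt (fun t : ℝ => X + (t - X l) • e) e t := by
      simpa using (((hasDerivAt_id t).sub_const (X l)).smul_const e).const_add X
    rw [Function.iterate_succ_apply']
    exact ((contDiff_dirD_iterate (v := e) hf k).differentiable (by simp)
      (X + (t - X l) • e)).hasFDerivAt.comp_hasDerivAt t h1
  have hzero (k : ℕ) : (dirD e)^[k] f (X + (0 - X l) • e) = 0 :=
    hvan k _ (closedBall_subset_ball (by linarith) (hupd (by simpa using hr.le))) (by simp [e])
  have hle (n : ℕ) (hn : 0 < n) : ‖f X‖ ≤ M * (Real.exp 1 * C * |X l| / r) ^ n := by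
    have hM0 : 0 ≤ M := (norm_nonneg _).trans (hM X₀ (mem_closedBall_self (by linarith)))
    have h1 := norm_le_mul_abs_pow_div_factorial hderiv hzero n
      (fun t ht => hbound n hn (hupd ht)) hXl
    simp only [sub_self, zero_smul, add_zero, Function.iterate_zero, id_eq] at h1
    have h2 := Real.pow_div_factorial_le_exp (n : ℝ) (Nat.cast_nonneg n) n
    calc ‖f X‖ ≤ _ := h1
      _ = M * (C * |X l| / r) ^ n * ((n : ℝ) ^ n / n.factorial) := by
        rw [div_div_eq_mul_div, div_pow, div_pow, mul_pow, mul_pow]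
        ring
      _ ≤ M * (C * |X l| / r) ^ n * Real.exp n := by gcongr
      _ = _ := by
        rw [← Real.exp_one_pow, mul_assoc M, ← mul_pow]
        ring
  have hlim : Tendsto (fun n : ℕ => M * (Real.exp 1 * C * |X l| / r) ^ n) atTop (𝓝 (M * 0)) :=
    (tendsto_pow_atTop_nhds_zero_of_lt_one (by positivity) hXq).const_mul M
  rw [mul_zero] at hlim
  have := ge_of_tendsto hlim ((eventually_gt_atTop 0).mono hle)
  exact norm_le_zero_iff.1 this

/-- A monogenic function vanishing on the hyperplane `X_l = 0` vanishes near it. -/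
theorem eventually_eq_zero_of_diracOp_eq_zero (hc : CliffordRel c) {f : (Fin m → ℝ) → V}
    {Ω : Set (Fin m → ℝ)} (hΩ : IsOpen Ω) (hf : ContDiffOn ℝ 1 f Ω)
    (hfd : ∀ X ∈ Ω, diracOp c f X = 0) {l : Fin m} {X₀ : Fin m → ℝ} (hX₀Ω : X₀ ∈ Ω)
    (hX₀ : X₀ l = 0) (h0 : ∀ᶠ X in 𝓝 X₀, X l = 0 → f X = 0) : ∀ᶠ X in 𝓝 X₀, f X = 0 := by
  obtain ⟨κ⟩ := RadialKernel.nonempty m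
  obtain ⟨R, hR, hRsub⟩ := Metric.eventually_nhds_iff_ball.1
    ((hΩ.eventually_mem hX₀Ω).and h0)
  have hΩ' (X : Fin m → ℝ) (hX : X ∈ ball X₀ R) : X ∈ Ω := (hRsub X hX).1
  let χ : ContDiffBump X₀ := ⟨R / 2, 3 * R / 4, by linarith, by linarith⟩
  let g : (Fin m → ℝ) → V := fun X => χ X • f X
  have hg : ContDiff ℝ 1 g := by
    rw [contDiff_iff_contDiffAt]
    intro X
    by_cases hX : X ∈ ball X₀ R
    · exact (χ.contDiff.contDiffAt).smul (hf.contDiffAt (hΩ.mem_nhds (hΩ' X hX)))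
    · have hnot : X ∉ tsupport χ := by
        rw [χ.tsupport_eq]
        intro h
        exact hX (closedBall_subset_ball (by simp only [χ]; linarith) h)
      refine (contDiffAt_const (c := (0 : V))).congr_of_eventuallyEq ?_
      filter_upwards [(notMem_tsupport_iff_eventuallyEq.1 hnot)] with Y hY
      simp [g, hY]
  have hgf : EqOn g f (ball X₀ (R / 2)) := fun X hX => by
    have : χ X = 1 := χ.one_of_mem_closedBall (ball_subset_closedBall hX)
    simp [g, this]
  have hgd : ∀ Y ∈ ball X₀ (R / 2), diracOp c g Y = 0 := fun Y hY => by
    rw [diracOp_congr_of_eventuallyEq (hgf.eventuallyEq_of_mem (isOpen_ball.mem_nhds hY))]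
    exact hfd Y (hΩ' Y (ball_subset_ball (by linarith) hY))
  obtain ⟨G, hG, hGg⟩ := κ.exists_contDiff_eqOn hc hg (δ := R / 6) (X₀ := X₀) (by positivity)
    fun Y hY => hgd Y (closedBall_subset_ball (by linarith) hY)
  have hGf : EqOn G f (ball X₀ (R / 6)) := fun X hX =>
    (hGg (ball_subset_closedBall hX)).trans (hgf (ball_subset_ball (by linarith) hX))
  have h3 : 3 * (R / 18) = R / 6 := by ring
  have hGz := eventually_eq_zero_of_contDiff hc hG hX₀ (r := R / 18) (by positivity)
    (fun X hX => ?_) (fun X hX hXl => ?_)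
  · filter_upwards [hGz, ball_mem_nhds X₀ (by positivity : 0 < R / 6)] with X hX hXR
    rw [← hGf hXR, hX]
  · rw [h3] at hX
    rw [diracOp_congr_of_eventuallyEq (hGf.eventuallyEq_of_mem (isOpen_ball.mem_nhds hX))]
    exact hfd X (hΩ' X (ball_subset_ball (by linarith) hX))
  · rw [h3] at hX
    rw [hGf hX]
    exact (hRsub X (ball_subset_ball (by linarith) hX)).2 hXl

end Uniqueness

section CliffordAlgebra

theorem er_mul_er_add_swap (m : ℕ) (α β : Fin m) :
    er m α * er m β + er m β * er m α = algebraMap ℝ (ClR m) (if α = β then -2 else 0) := by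
  rw [er, er, CliffordAlgebra.ι_mul_ι_add_swap, QuadraticMap.polar]
  congr 1
  simp only [negQ, QuadraticMap.weightedSumSquares_apply, ← Finset.sum_sub_distrib]
  rw [Finset.sum_eq_single α]
  · rcases eq_or_ne α β with rfl | h
    · norm_num
    · simp [h]
  · intro i _ hi
    simp [hi]
  · simp

instance finiteDimensional_clR (m : ℕ) : FiniteDimensional ℝ (ClR m) :=
  haveI : Module.Finite ℝ (ExteriorAlgebra ℝ (Fin m → ℝ)) :=
    Module.Finite.of_basis (Pi.basisFun ℝ (Fin m)).ExteriorAlgebra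
  Module.Finite.equiv (CliffordAlgebra.equivExterior (negQ ℝ m)).symm

/-- Linear coordinates on the finite-dimensional space `ℝ_{0,m}`. -/
def clCoord (m : ℕ) : ClR m ≃ₗ[ℝ] (Fin (Module.finrank ℝ (ClR m)) → ℝ) :=
  (Module.finBasis ℝ (ClR m)).equivFun

/-- Left multiplication by `e_α` in linear coordinates. -/
def clAct (m : ℕ) (α : Fin m) :
    (Fin (Module.finrank ℝ (ClR m)) → ℝ) →L[ℝ] (Fin (Module.finrank ℝ (ClR m)) → ℝ) :=
  LinearMap.toContinuousLinearMap
    ((clCoord m).toLinearMap ∘ₗ LinearMap.mulLeft ℝ (er m α) ∘ₗ (clCoord m).symm.toLinearMap)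

theorem clAct_apply {m : ℕ} (α : Fin m) (w : Fin (Module.finrank ℝ (ClR m)) → ℝ) :
    clAct m α w = clCoord m (er m α * (clCoord m).symm w) := rfl

theorem cliffordRel_clAct (m : ℕ) : CliffordRel (clAct m) := by
  intro α β v
  simp only [clAct_apply, LinearEquiv.symm_apply_apply, ← mul_assoc, ← map_add, ← add_mul,
    er_mul_er_add_swap, ← Algebra.smul_def, map_smul, LinearEquiv.apply_symm_apply]
  split_ifs <;> simp

variable {m k : ℕ} {f : (Fin k → ℝ) → ClR m} {z v : Fin k → ℝ}

theorem HasDirDerivR.unique {d d' : ClR m} (h : HasDirDerivR f z v d)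
    (h' : HasDirDerivR f z v d') : d = d' :=
  (clCoord m).injective <| funext fun i =>
    (h (LinearMap.proj i ∘ₗ (clCoord m).toLinearMap)).unique (h' _)

theorem HasDirDerivR.dirDerivR_eq {d : ClR m} (h : HasDirDerivR f z v d) : dirDerivR f v z = d :=
  HasDirDerivR.unique (Classical.epsilon_spec (p := fun d => HasDirDerivR f z v d) ⟨d, h⟩) h

theorem hasDirDerivR_of_differentiableAt (hf : DifferentiableAt ℝ (fun x => clCoord m (f x)) z) :
    HasDirDerivR f z v ((clCoord m).symm (fderiv ℝ (fun x => clCoord m (f x)) z v)) := by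
  intro φ
  let L := LinearMap.toContinuousLinearMap (φ ∘ₗ (clCoord m).symm.toLinearMap)
  have h1 : HasDerivAt (fun t : ℝ => z + t • v) v 0 := by
    simpa using ((hasDerivAt_id (0 : ℝ)).smul_const v).const_add z
  have h2 : HasFDerivAt (fun x => clCoord m (f x)) (fderiv ℝ (fun x => clCoord m (f x)) z)
      (z + (0 : ℝ) • v) := by simpa using hf.hasFDerivAt
  have h3 := L.hasFDerivAt.comp_hasDerivAt (0 : ℝ) (h2.comp_hasDerivAt (0 : ℝ) h1)
  simpa [L, Function.comp_def] using h3

theorem clCoord_diracR {f : (Fin m → ℝ) → ClR m} {X : Fin m → ℝ}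
    (hf : DifferentiableAt ℝ (fun x => clCoord m (f x)) X) :
    clCoord m (diracR m f X) = diracOp (clAct m) (fun x => clCoord m (f x)) X := by
  simp only [diracR, diracOp, map_sum, (hasDirDerivR_of_differentiableAt hf).dirDerivR_eq,
    clAct_apply]

theorem monogenicOn_iff {f : (Fin m → ℝ) → ClR m} {Ω : Set (Fin m → ℝ)} (hΩ : IsOpen Ω) :
    MonogenicOn m f Ω ↔ ContDiffOn ℝ 1 (fun x => clCoord m (f x)) Ω ∧
      ∀ X ∈ Ω, diracOp (clAct m) (fun x => clCoord m (f x)) X = 0 := by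
  have h1 : (∀ φ : ClR m →ₗ[ℝ] ℝ, ContDiffOn ℝ 1 (fun X => φ (f X)) Ω) ↔
      ContDiffOn ℝ 1 (fun x => clCoord m (f x)) Ω := by
    refine ⟨fun h => contDiffOn_pi.2 fun i =>
      h (LinearMap.proj i ∘ₗ (clCoord m).toLinearMap), fun h φ => ?_⟩
    simpa [Function.comp_def] using (LinearMap.toContinuousLinearMap
      (φ ∘ₗ (clCoord m).symm.toLinearMap)).contDiff.comp_contDiffOn h
  rw [MonogenicOn, h1]
  refine and_congr_right fun h => forall₂_congr fun X hX => ?_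
  rw [← clCoord_diracR ((h.differentiableOn (by simp)).differentiableAt (hΩ.mem_nhds hX)),
    LinearEquiv.map_eq_zero_iff]

theorem RealAnalyticOnR.analyticOnNhd_clCoord {Ω : Set (Fin k → ℝ)} (hf : RealAnalyticOnR f Ω) :
    AnalyticOnNhd ℝ (fun x => clCoord m (f x)) Ω :=
  AnalyticOnNhd.pi fun i => hf (LinearMap.proj i ∘ₗ (clCoord m).toLinearMap)

end CliffordAlgebra

section Hyperplane

variable {m : ℕ}

/-- The last coordinate index. -/
def lastIdx (hm : 2 ≤ m) : Fin m := ⟨m - 1, by lia⟩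

theorem sum_eq_sum_castLE_add {V : Type*} [AddCommMonoid V] (hm : 2 ≤ m) (g : Fin m → V) :
    ∑ α, g α = ∑ i : Fin (m - 1), g (Fin.castLE (Nat.sub_le m 1) i) + g (lastIdx hm) := by
  obtain ⟨k, rfl⟩ : ∃ k, m = k + 1 := ⟨m - 1, by lia⟩
  exact Fin.sum_univ_castSucc g

/-- The splitting of a vector of `ℝ^m` into its first `m - 1` coordinates and its last one. -/
def splitLast (hm : 2 ≤ m) : (Fin m → ℝ) →L[ℝ] (Fin (m - 1) → ℝ) × ℝ :=
  (ContinuousLinearMap.pi fun i =>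
    ContinuousLinearMap.proj (Fin.castLE (Nat.sub_le m 1) i)).prod
    (ContinuousLinearMap.proj (lastIdx hm))

variable (hm : 2 ≤ m)

theorem splitLast_embR (x : Fin (m - 1) → ℝ) : splitLast hm (embR m x) = (x, 0) := by
  refine Prod.ext (funext fun i => ?_) ?_
  · simp [splitLast, embR]
  · simp [splitLast, embR, lastIdx]

theorem embR_splitLast {X : Fin m → ℝ} (hX : X (lastIdx hm) = 0) :
    embR m (splitLast hm X).1 = X := by
  funext i
  rw [embR]
  split_ifs with h
  · rfl
  · rw [← hX]
    exact congrArg X (Fin.ext (by simp only [lastIdx]; lia))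

theorem splitLast_single_castLE (i : Fin (m - 1)) :
    splitLast hm (Pi.single (Fin.castLE (Nat.sub_le m 1) i) 1) = (Pi.single i 1, 0) := by
  refine Prod.ext (funext fun j => ?_) ?_
  · simp [splitLast, Pi.single_apply]
  · have : lastIdx hm ≠ Fin.castLE (Nat.sub_le m 1) i := by
      simp only [ne_eq, Fin.ext_iff, lastIdx, Fin.val_castLE]
      lia
    simp [splitLast, this]

theorem splitLast_single_last : splitLast hm (Pi.single (lastIdx hm) 1) = (0, 1) := by
  refine Prod.ext (funext fun j => ?_) ?_
  · have : Fin.castLE (Nat.sub_le m 1) j ≠ lastIdx hm := by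
      simp only [ne_eq, Fin.ext_iff, lastIdx, Fin.val_castLE]
      lia
    simp [splitLast, this]
  · simp [splitLast]

theorem exists_monogenic_extension (hm : 2 ≤ m) {Ωt : Set (Fin (m - 1) → ℝ)}
    {ft : (Fin (m - 1) → ℝ) → ClR m}
    (hft : RealAnalyticOnR ft Ωt) : ∃ (Ω : Set (Fin m → ℝ)) (f : (Fin m → ℝ) → ClR m),
      IsOpen Ω ∧ (∀ x ∈ Ωt, embR m x ∈ Ω) ∧ MonogenicOn m f Ω ∧
      ∀ x, f (embR m x) = ft x := by
  let c := clAct m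
  let l := lastIdx hm
  obtain ⟨U, F, hU, hΩU, hF, hF0, hFd⟩ := exists_cauchyKovalevskaya_extension
    (fun i : Fin (m - 1) => (Pi.single i 1 : Fin (m - 1) → ℝ))
    (fun i => c l ∘L c (Fin.castLE (Nat.sub_le m 1) i)) hft.analyticOnNhd_clCoord
  have hΩ : IsOpen (splitLast hm ⁻¹' U) := hU.preimage (splitLast hm).continuous
  refine ⟨splitLast hm ⁻¹' U, fun X => (clCoord m).symm (F (splitLast hm X)), hΩ,
    fun x hx => ?_, (monogenicOn_iff hΩ).2 ?_, fun x => ?_⟩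
  · rw [mem_preimage, splitLast_embR]
    exact hΩU x hx
  · simp only [LinearEquiv.apply_symm_apply]
    refine ⟨hF.comp (splitLast hm).contDiff.contDiffOn (mapsTo_preimage _ _), fun X hX => ?_⟩
    have hd : HasFDerivAt (fun X => F (splitLast hm X))
        (fderiv ℝ F (splitLast hm X) ∘L splitLast hm) X :=
      ((hF.differentiableOn (by simp)).differentiableAt
        (hU.mem_nhds hX)).hasFDerivAt.comp X (splitLast hm).hasFDerivAt
    have hsq (w) : c l (c l w) = -w := by
      have h := cliffordRel_clAct m l l w
      rw [if_pos rfl, ← two_smul ℝ, neg_smul, ← smul_neg] at h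
      exact smul_right_injective _ (two_ne_zero (α := ℝ)) h
    rw [diracOp, sum_eq_sum_castLE_add hm]
    simp only [hd.fderiv, ContinuousLinearMap.comp_apply, splitLast_single_castLE,
      splitLast_single_last, hFd _ hX, map_sum]
    rw [← Finset.sum_add_distrib]
    refine Finset.sum_eq_zero fun i _ => ?_
    rw [show clAct m (lastIdx hm) (c l _) = _ from hsq _]
    exact add_neg_cancel _
  · simp only [splitLast_embR, hF0, LinearEquiv.symm_apply_apply]

theorem MonogenicOn.eventually_eq (hm : 2 ≤ m) {Ωt : Set (Fin (m - 1) → ℝ)} (hΩt : IsOpen Ωt)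
    {Ω : Set (Fin m → ℝ)} (hΩ : IsOpen Ω) {f₁ f₂ : (Fin m → ℝ) → ClR m}
    (h₁ : MonogenicOn m f₁ Ω) (h₂ : MonogenicOn m f₂ Ω)
    (h : ∀ x ∈ Ωt, f₁ (embR m x) = f₂ (embR m x)) {x : Fin (m - 1) → ℝ} (hx : x ∈ Ωt)
    (hxΩ : embR m x ∈ Ω) : ∀ᶠ X in 𝓝 (embR m x), f₁ X = f₂ X := by
  obtain ⟨hf₁, hd₁⟩ := (monogenicOn_iff hΩ).1 h₁
  obtain ⟨hf₂, hd₂⟩ := (monogenicOn_iff hΩ).1 h₂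
  have hsplit := splitLast_embR hm x
  have hfd : ∀ X ∈ Ω, diracOp (clAct m) (fun X => clCoord m (f₁ X) - clCoord m (f₂ X)) X = 0 := by
    intro X hX
    have := fderiv_fun_sub
      ((hf₁.differentiableOn (by simp)).differentiableAt (hΩ.mem_nhds hX))
      ((hf₂.differentiableOn (by simp)).differentiableAt (hΩ.mem_nhds hX))
    have e₁ := hd₁ X hX
    have e₂ := hd₂ X hX
    rw [diracOp] at e₁ e₂ ⊢
    simp only [this, FunLike.coe_sub, Pi.sub_apply, map_sub, Finset.sum_sub_distrib, e₁, e₂,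
      sub_self]
  have hl : embR m x (lastIdx hm) = 0 := congrArg Prod.snd hsplit
  have h0 : ∀ᶠ X in 𝓝 (embR m x), X (lastIdx hm) = 0 →
      clCoord m (f₁ X) - clCoord m (f₂ X) = 0 := by
    have hcont : Continuous fun X => (splitLast hm X).1 := (splitLast hm).continuous.fst
    filter_upwards [hcont.continuousAt.eventually_mem (hΩt.mem_nhds (by rw [hsplit]; exact hx))]
      with X hX hXl
    have := h _ hX
    rw [embR_splitLast hm hXl] at this
    rw [this, sub_self]
  filter_upwards [eventually_eq_zero_of_diracOp_eq_zero (cliffordRel_clAct m) hΩ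
    (hf₁.sub hf₂) hfd hxΩ hl h0] with X hX
  exact (clCoord m).injective (sub_eq_zero.1 hX)

end Hyperplane

theorem MonogenicOn.mono {m : ℕ} {f : (Fin m → ℝ) → ClR m} {Ω Ω' : Set (Fin m → ℝ)}
    (h : MonogenicOn m f Ω) (hΩ : Ω' ⊆ Ω) : MonogenicOn m f Ω' :=
  ⟨fun φ => (h.1 φ).mono hΩ, fun X hX => h.2 X (hΩ hX)⟩

/-- **Cauchy–Kovalevskaya extension theorem in Euclidean Clifford analysis.**
A real-analytic function `f̃` on an open set `Ω̃ ⊆ ℝ^{m-1} = {X ∈ ℝ^m : X_m = 0}` with values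
in `ℝ_{0,m}` extends to a monogenic function `f` on an open neighbourhood `Ω` of `Ω̃ × {0}`
in `ℝ^m`; the extension is unique in the sense that any two monogenic functions defined on
open neighbourhoods of `Ω̃ × {0}` restricting to `f̃` there agree on some open neighbourhood
of `Ω̃ × {0}`. -/
theorem ck_extension_monogenic
    (m : ℕ) (hm : 2 ≤ m)
    (Ωt : Set (Fin (m - 1) → ℝ)) (hΩt : IsOpen Ωt)
    (ft : (Fin (m - 1) → ℝ) → ClR m) (hft : RealAnalyticOnR ft Ωt) :
    (∃ (Ω : Set (Fin m → ℝ)) (f : (Fin m → ℝ) → ClR m),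
      IsOpen Ω ∧ (∀ x ∈ Ωt, embR m x ∈ Ω) ∧
      MonogenicOn m f Ω ∧
      (∀ x ∈ Ωt, f (embR m x) = ft x)) ∧
    (∀ (Ω₁ Ω₂ : Set (Fin m → ℝ)) (f₁ f₂ : (Fin m → ℝ) → ClR m),
      IsOpen Ω₁ → IsOpen Ω₂ →
      (∀ x ∈ Ωt, embR m x ∈ Ω₁) → (∀ x ∈ Ωt, embR m x ∈ Ω₂) →
      MonogenicOn m f₁ Ω₁ → MonogenicOn m f₂ Ω₂ →
      (∀ x ∈ Ωt, f₁ (embR m x) = ft x) → (∀ x ∈ Ωt, f₂ (embR m x) = ft x) →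
      ∃ V : Set (Fin m → ℝ), IsOpen V ∧ (∀ x ∈ Ωt, embR m x ∈ V) ∧
        V ⊆ Ω₁ ∩ Ω₂ ∧ Set.EqOn f₁ f₂ V) := by
  refine ⟨?_, ?_⟩
  · obtain ⟨Ω, f, hΩ, hsub, hf, hf0⟩ := exists_monogenic_extension hm hft
    exact ⟨Ω, f, hΩ, hsub, hf, fun x _ => hf0 x⟩
  · intro Ω₁ Ω₂ f₁ f₂ hΩ₁ hΩ₂ hs₁ hs₂ h₁ h₂ he₁ he₂
    have hΩ := hΩ₁.inter hΩ₂
    refine ⟨interior {X | X ∈ Ω₁ ∩ Ω₂ ∧ f₁ X = f₂ X}, isOpen_interior, fun x hx => ?_,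
      fun X hX => (interior_subset hX).1, fun X hX => (interior_subset hX).2⟩
    have hxΩ : embR m x ∈ Ω₁ ∩ Ω₂ := ⟨hs₁ x hx, hs₂ x hx⟩
    exact mem_interior_iff_mem_nhds.2 ((hΩ.eventually_mem hxΩ).and
      (MonogenicOn.eventually_eq hm hΩt hΩ (h₁.mono inter_subset_left) (h₂.mono inter_subset_right)
        (fun y hy => (he₁ y hy).trans (he₂ y hy).symm) hx hxΩ))
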